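/- Under the setting of the perturbed equality-constrained quadratic program (H symmetric positive definite, A full row rank, unperturbed minimizer z* with multiplier κ*, and d = -H⁻¹(Aᵀ k̃ + H̃ z* + ẽ) where k̃ = M (M̃ κ* − m̃)), the optimal values satisfy: if v* = (1/2) z*ᵀ H z* + eᵀ z* and ṽ*_ε = (1/2) z̃*_εᵀ (H + ε H̃) z̃*_ε + (e + ε ẽ)ᵀ z̃*_ε, then ṽ*_ε − v* = ε ( g̃(z*) + (H z* + e)ᵀ d ) + o(ε) as ε → 0, where g̃(z*) = (1/2) z*ᵀ H̃ z* + ẽᵀ z*. -/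

import Mathlib

open Matrix Asymptotics Filter Topology

/-- On a finite-dimensional space every quadratic form is bounded by a multiple of a given positive
definite one. -/
theorem Matrix.PosDef.exists_abs_dotProduct_mulVec_le {n : Type*} [Fintype n]
    {H : Matrix n n ℝ} (hH : H.PosDef) (B : Matrix n n ℝ) :
    ∃ C : ℝ, 0 ≤ C ∧ ∀ u : n → ℝ, |u ⬝ᵥ B *ᵥ u| ≤ C * (u ⬝ᵥ H *ᵥ u) := by
  have hpos : ∀ u : n → ℝ, u ≠ 0 → 0 < u ⬝ᵥ H *ᵥ u := fun u hu => by
    simpa using hH.dotProduct_mulVec_pos hu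
  have hcont : ∀ K : Matrix n n ℝ, Continuous fun u : n → ℝ => u ⬝ᵥ K *ᵥ u := fun K =>
    continuous_id.dotProduct (continuous_const.matrix_mulVec continuous_id)
  obtain ⟨C, hC⟩ := (isCompact_sphere (0 : n → ℝ) 1).exists_bound_of_continuousOn
    (f := fun u => |u ⬝ᵥ B *ᵥ u| / (u ⬝ᵥ H *ᵥ u))
    ((hcont B).abs.continuousOn.div (hcont H).continuousOn fun u hu =>
      (hpos u (ne_zero_of_mem_unit_sphere ⟨u, hu⟩)).ne')
  refine ⟨max C 0, le_max_right _ _, fun u => ?_⟩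
  rcases eq_or_ne u 0 with rfl | hu
  · simp
  have hr : 0 < ‖u‖ := norm_pos_iff.mpr hu
  have h := (le_abs_self _).trans (hC (‖u‖⁻¹ • u) (by simp [norm_smul, hr.ne']))
  have hscale : |(‖u‖⁻¹ • u) ⬝ᵥ B *ᵥ (‖u‖⁻¹ • u)| / ((‖u‖⁻¹ • u) ⬝ᵥ H *ᵥ (‖u‖⁻¹ • u))
      = |u ⬝ᵥ B *ᵥ u| / (u ⬝ᵥ H *ᵥ u) := by
    have := (hpos u hu).ne'
    simp only [mulVec_smul, dotProduct_smul, smul_dotProduct, smul_eq_mul, abs_mul, abs_inv,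
      abs_norm]
    field_simp
  rw [hscale] at h
  exact (div_le_iff₀ (hpos u hu)).mp (h.trans (le_max_left _ _))

/-- A matrix of full row rank compresses a positive definite matrix to a positive definite one. -/
theorem Matrix.PosDef.mul_mul_transpose_of_rank_eq {p s : ℕ} {K : Matrix (Fin p) (Fin p) ℝ}
    (hK : K.PosDef) {A : Matrix (Fin s) (Fin p) ℝ} (hA : A.rank = s) :
    (A * K * Aᵀ).PosDef := by
  have hinj : Function.Injective A.vecMul := by
    rw [vecMul_injective_iff, linearIndependent_iff_card_eq_finrank_span, Set.finrank,
      ← rank_eq_finrank_span_row, hA, Fintype.card_fin]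
  simpa using hK.mul_mul_conjTranspose_same hinj

theorem Matrix.IsSymm.dotProduct_mulVec_comm {n R : Type*} [Fintype n] [CommSemiring R]
    {K : Matrix n n R} (hK : K.IsSymm) (x y : n → R) : x ⬝ᵥ K *ᵥ y = y ⬝ᵥ K *ᵥ x := by
  rw [dotProduct_mulVec, ← mulVec_transpose, hK.eq, dotProduct_comm]

/-- Second-order expansion of a quadratic objective, exact at any base point. -/
theorem quadratic_objective_add {n : Type*} [Fintype n] {K : Matrix n n ℝ} (hK : K.IsSymm)
    (c w u : n → ℝ) :
    (1/2) * ((w + u) ⬝ᵥ K *ᵥ (w + u)) + c ⬝ᵥ (w + u)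
      = ((1/2) * (w ⬝ᵥ K *ᵥ w) + c ⬝ᵥ w) + u ⬝ᵥ (K *ᵥ w + c) + (1/2) * (u ⬝ᵥ K *ᵥ u) := by
  simp only [mulVec_add, dotProduct_add, add_dotProduct]
  rw [hK.dotProduct_mulVec_comm w u, dotProduct_comm c u]
  ring

/-- The objective of the perturbed program along a line, to third order in the perturbation. -/
theorem perturbed_objective_along_line {n : Type*} [Fintype n] {H Ht : Matrix n n ℝ}
    (hH : H.IsSymm) (hHt : Ht.IsSymm) (e et z d : n → ℝ) (ε : ℝ) :
    (1/2) * ((z + ε • d) ⬝ᵥ (H + ε • Ht) *ᵥ (z + ε • d)) + (e + ε • et) ⬝ᵥ (z + ε • d)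
      = ((1/2) * (z ⬝ᵥ H *ᵥ z) + e ⬝ᵥ z)
        + ε * (((1/2) * (z ⬝ᵥ Ht *ᵥ z) + et ⬝ᵥ z) + (H *ᵥ z + e) ⬝ᵥ d)
        + ε ^ 2 * ((1/2) * (d ⬝ᵥ H *ᵥ d) + d ⬝ᵥ Ht *ᵥ z + et ⬝ᵥ d)
        + ε ^ 3 * ((1/2) * (d ⬝ᵥ Ht *ᵥ d)) := by
  simp only [mulVec_add, add_mulVec, smul_mulVec, mulVec_smul, dotProduct_add, add_dotProduct,
    smul_dotProduct, dotProduct_smul, smul_eq_mul]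
  rw [hH.dotProduct_mulVec_comm z d, hHt.dotProduct_mulVec_comm z d, dotProduct_comm (H *ᵥ z) d]
  ring

/-- Near `ε = 0`, a perturbed positive definite form plus a linear term of size `ε ^ 2` is bounded
below by a multiple of `ε ^ 2`, uniformly in the argument. -/
theorem Matrix.PosDef.eventually_perturbed_lower_bound {n : Type*} [Fintype n]
    {H : Matrix n n ℝ} (hH : H.PosDef) (B : Matrix n n ℝ) (q : n → ℝ) :
    ∀ᶠ ε : ℝ in 𝓝 0, ∀ u : n → ℝ,
      -(ε ^ 2 * (q ⬝ᵥ q)) ≤ ε ^ 2 * (u ⬝ᵥ q) + (1/2) * (u ⬝ᵥ (H + ε • B) *ᵥ u) := by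
  classical
  obtain ⟨C, hC, hCB⟩ := hH.exists_abs_dotProduct_mulVec_le B
  obtain ⟨D, hD, hD1⟩ := hH.exists_abs_dotProduct_mulVec_le (1 : Matrix n n ℝ)
  have h1 : ∀ᶠ ε : ℝ in 𝓝 0, |ε| * C < 1 / 2 := by
    have : Continuous fun ε : ℝ => |ε| * C := by fun_prop
    exact this.tendsto 0 |>.eventually_lt_const (by norm_num)
  have h2 : ∀ᶠ ε : ℝ in 𝓝 0, ε ^ 2 * D < 1 / 2 := by
    have : Continuous fun ε : ℝ => ε ^ 2 * D := by fun_prop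
    exact this.tendsto 0 |>.eventually_lt_const (by norm_num)
  filter_upwards [h1, h2] with ε h1 h2 u
  have hu : 0 ≤ u ⬝ᵥ H *ᵥ u := by simpa using hH.posSemidef.dotProduct_mulVec_nonneg u
  have hB : -((1/2) * (u ⬝ᵥ H *ᵥ u)) ≤ ε * (u ⬝ᵥ B *ᵥ u) := by
    refine neg_le_of_abs_le ?_
    rw [abs_mul]
    calc |ε| * |u ⬝ᵥ B *ᵥ u| ≤ |ε| * (C * (u ⬝ᵥ H *ᵥ u)) := by gcongr; exact hCB u
      _ = |ε| * C * (u ⬝ᵥ H *ᵥ u) := by ring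
      _ ≤ 1 / 2 * (u ⬝ᵥ H *ᵥ u) := by gcongr
  have hI : ε ^ 2 * (u ⬝ᵥ u) ≤ 1 / 2 * (u ⬝ᵥ H *ᵥ u) := by
    have := (le_abs_self _).trans (hD1 u)
    rw [one_mulVec] at this
    calc ε ^ 2 * (u ⬝ᵥ u) ≤ ε ^ 2 * (D * (u ⬝ᵥ H *ᵥ u)) := by gcongr
      _ = ε ^ 2 * D * (u ⬝ᵥ H *ᵥ u) := by ring
      _ ≤ 1 / 2 * (u ⬝ᵥ H *ᵥ u) := by gcongr
  have hsq : 0 ≤ (u + (2 : ℝ) • q) ⬝ᵥ (u + (2 : ℝ) • q) :=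
    Finset.sum_nonneg fun i _ => mul_self_nonneg _
  simp only [add_dotProduct, dotProduct_add, smul_dotProduct, dotProduct_smul, smul_eq_mul,
    dotProduct_comm q u] at hsq
  have hsq' := mul_nonneg (sq_nonneg ε) hsq
  simp only [add_mulVec, smul_mulVec, dotProduct_add, dotProduct_smul, smul_eq_mul]
  linarith

/-- First-order perturbation of the optimal value of the perturbed
equality-constrained quadratic program:
`ṽ*_ε − v* = ε (g̃(z*) + ∇g(z*)ᵀ d) + o(ε)` where `∇g(z*) = H z* + e`,
`g̃(z*) = (1/2) z*ᵀ H̃ z* + ẽᵀ z*`, and `d = -H⁻¹(Aᵀ k̃ + H̃ z* + ẽ)`. -/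
theorem stmt7 {p s : ℕ}
    (H Ht : Matrix (Fin p) (Fin p) ℝ) (hH : H.PosDef) (hHt : Ht.IsSymm)
    (e et : Fin p → ℝ)
    (A : Matrix (Fin s) (Fin p) ℝ) (hA : A.rank = s)
    (b bt : Fin s → ℝ)
    (M : Matrix (Fin s) (Fin s) ℝ) (hM : M = (A * H⁻¹ * Aᵀ)⁻¹)
    (Mt : Matrix (Fin s) (Fin s) ℝ) (hMt : Mt = A * H⁻¹ * Ht * H⁻¹ * Aᵀ)
    (mt : Fin s → ℝ)
    (hmt : mt = A.mulVec (H⁻¹.mulVec et) + bt - A.mulVec (H⁻¹.mulVec (Ht.mulVec (H⁻¹.mulVec e))))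
    (κstar : Fin s → ℝ)
    (hκ : κstar = -M.mulVec (A.mulVec (H⁻¹.mulVec e) + b))
    (zstar : Fin p → ℝ)
    (hzstar : zstar = -(H⁻¹.mulVec (e + Aᵀ.mulVec κstar)))
    (hzmin : A.mulVec zstar = b ∧
      ∀ z : Fin p → ℝ, A.mulVec z = b → z ≠ zstar →
        (1/2) * (zstar ⬝ᵥ H.mulVec zstar) + e ⬝ᵥ zstar
          < (1/2) * (z ⬝ᵥ H.mulVec z) + e ⬝ᵥ z)
    (kt : Fin s → ℝ) (hkt : kt = M.mulVec (Mt.mulVec κstar - mt))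
    (d : Fin p → ℝ)
    (hd : d = -(H⁻¹.mulVec (Aᵀ.mulVec kt + Ht.mulVec zstar + et)))
    (zpert : ℝ → (Fin p → ℝ))
    (hzpert : ∀ᶠ ε : ℝ in 𝓝 0,
      A.mulVec (zpert ε) = b + ε • bt ∧
      ∀ z : Fin p → ℝ, A.mulVec z = b + ε • bt → z ≠ zpert ε →
        (1/2) * (zpert ε ⬝ᵥ (H + ε • Ht).mulVec (zpert ε)) + (e + ε • et) ⬝ᵥ zpert ε
          < (1/2) * (z ⬝ᵥ (H + ε • Ht).mulVec z) + (e + ε • et) ⬝ᵥ z) :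
    (fun ε : ℝ =>
        ((1/2) * (zpert ε ⬝ᵥ (H + ε • Ht).mulVec (zpert ε)) + (e + ε • et) ⬝ᵥ zpert ε)
        - ((1/2) * (zstar ⬝ᵥ H.mulVec zstar) + e ⬝ᵥ zstar)
        - ε * (((1/2) * (zstar ⬝ᵥ Ht.mulVec zstar) + et ⬝ᵥ zstar)
            + (H.mulVec zstar + e) ⬝ᵥ d)) =o[𝓝 0] (fun ε : ℝ => ε) := by
  have hHs : H.IsSymm := by simpa using hH.isHermitian
  have hHu : IsUnit H.det := (isUnit_iff_isUnit_det _).mp hH.isUnit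
  have hSu : IsUnit (A * H⁻¹ * Aᵀ).det :=
    (isUnit_iff_isUnit_det _).mp (hH.inv.mul_mul_transpose_of_rank_eq hA).isUnit
  have hHinv : ∀ v, H *ᵥ (H⁻¹ *ᵥ v) = v := fun v => by
    rw [mulVec_mulVec, mul_nonsing_inv _ hHu, one_mulVec]
  have hSinv : ∀ v, A *ᵥ (H⁻¹ *ᵥ (Aᵀ *ᵥ (M *ᵥ v))) = v := fun v => by
    simp only [mulVec_mulVec]
    rw [hM, ← Matrix.mul_assoc, ← Matrix.mul_assoc, mul_nonsing_inv _ hSu, one_mulVec]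
  have hstat : H *ᵥ zstar + e = -(Aᵀ *ᵥ κstar) := by
    rw [hzstar, mulVec_neg, hHinv]
    abel
  have hstat_d : H *ᵥ d + Ht *ᵥ zstar + et = -(Aᵀ *ᵥ kt) := by
    rw [hd, mulVec_neg, hHinv]
    abel
  have hAd : A *ᵥ d = bt := by
    have hkt' : A *ᵥ (H⁻¹ *ᵥ (Aᵀ *ᵥ kt)) = Mt *ᵥ κstar - mt := by rw [hkt, hSinv]
    rw [hd, mulVec_neg, mulVec_add, mulVec_add, mulVec_add, mulVec_add, hkt', hMt, hmt, hzstar]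
    simp only [mulVec_add, mulVec_neg, mulVec_mulVec, Matrix.mul_assoc]
    abel
  have horth : ∀ u : Fin p → ℝ, A *ᵥ u = 0 → ∀ k : Fin s → ℝ, u ⬝ᵥ Aᵀ *ᵥ k = 0 := by
    intro u hu k
    rw [dotProduct_mulVec, vecMul_transpose, hu, zero_dotProduct]
  set c₂ : ℝ := (1/2) * (d ⬝ᵥ H *ᵥ d) + d ⬝ᵥ Ht *ᵥ zstar + et ⬝ᵥ d with hc₂
  set c₃ : ℝ := (1/2) * (d ⬝ᵥ Ht *ᵥ d) with hc₃
  set q : Fin p → ℝ := Ht *ᵥ d with hq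
  have hq0 : 0 ≤ q ⬝ᵥ q := Finset.sum_nonneg fun i _ => mul_self_nonneg _
  have hsmall : ∀ᶠ ε : ℝ in 𝓝 0, |ε| < 1 :=
    continuous_abs.tendsto (0 : ℝ) |>.eventually_lt_const (by norm_num)
  refine IsBigO.trans_isLittleO (g := fun ε : ℝ => ε ^ 2) ?_
    (by simpa using isLittleO_pow_id (𝕜 := ℝ) one_lt_two)
  refine IsBigO.of_bound (|c₂| + |c₃| + q ⬝ᵥ q) ?_
  filter_upwards [hzpert, hsmall, hH.eventually_perturbed_lower_bound Ht q]
    with ε ⟨hfeas, hmin⟩ hε hlow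
  have hline := perturbed_objective_along_line hHs hHt e et zstar d ε
  rw [← hc₂, ← hc₃] at hline
  have hwfeas : A *ᵥ (zstar + ε • d) = b + ε • bt := by
    rw [mulVec_add, mulVec_smul, hzmin.1, hAd]
  have hupper : (1/2) * (zpert ε ⬝ᵥ (H + ε • Ht) *ᵥ zpert ε) + (e + ε • et) ⬝ᵥ zpert ε
      ≤ (1/2) * ((zstar + ε • d) ⬝ᵥ (H + ε • Ht) *ᵥ (zstar + ε • d))
        + (e + ε • et) ⬝ᵥ (zstar + ε • d) := by
    rcases eq_or_ne (zstar + ε • d) (zpert ε) with h | h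
    · rw [h]
    · exact (hmin _ hwfeas h).le
  obtain ⟨u, hu⟩ : ∃ u, zpert ε = (zstar + ε • d) + u := ⟨_, (add_sub_cancel _ _).symm⟩
  have hAu : A *ᵥ u = 0 := by
    rw [hu, mulVec_add, hwfeas] at hfeas
    simpa using hfeas
  have hgrad : u ⬝ᵥ ((H + ε • Ht) *ᵥ (zstar + ε • d) + (e + ε • et)) = ε ^ 2 * (u ⬝ᵥ q) := by
    have : (H + ε • Ht) *ᵥ (zstar + ε • d) + (e + ε • et)
        = (H *ᵥ zstar + e) + ε • (H *ᵥ d + Ht *ᵥ zstar + et) + ε ^ 2 • q := by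
      simp only [hq, add_mulVec, mulVec_add, smul_mulVec, mulVec_smul]
      module
    rw [this, hstat, hstat_d]
    simp [horth u hAu]
  have hexp := quadratic_objective_add (hHs.add (hHt.smul ε)) (e + ε • et) (zstar + ε • d) u
  rw [← hu, hgrad] at hexp
  have hlow_u := hlow u
  have h₂ : |ε ^ 2 * c₂| = ε ^ 2 * |c₂| := by rw [abs_mul, abs_of_nonneg (sq_nonneg ε)]
  have h₃ : |ε ^ 3 * c₃| ≤ ε ^ 2 * |c₃| := by
    rw [abs_mul, pow_succ, abs_mul, abs_of_nonneg (sq_nonneg ε)]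
    gcongr
    exact mul_le_of_le_one_right (sq_nonneg ε) hε.le
  have h₂' := abs_le.mp h₂.le
  have h₃' := abs_le.mp h₃
  have h₄ := mul_nonneg (sq_nonneg ε) hq0
  rw [Real.norm_eq_abs, Real.norm_eq_abs, abs_of_nonneg (sq_nonneg ε), abs_le]
  constructor <;> linarith
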